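/- Let K be any field, n ≥ 2 and d ≥ 1 integers, and let S denote the matrix algebra M_d(L_K(n)). Then: (1) [S⁻, S⁻] is infinite dimensional over K; (2) S is infinite dimensional over K; and (3) with W = [S⁻, S⁻], one has [W, W] ≠ {0}. -/

import Mathlib

noncomputable section

open scoped BigOperators

attribute [local instance 100] LieRing.ofAssociativeRing

/-- The defining relations of the Cohn algebra `C_K(n)`: `y_i x_j = δ_{ij} 1`.
Generators of the free algebra: `Sum.inl i` is `x_i`, `Sum.inr i` is `y_i`.
Quotienting by this relation is the same as quotienting by the two-sided ideal
generated by the elements `y_i x_j - δ_{ij} 1`. -/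
inductive CohnRel (K : Type) [Field K] (n : ℕ) :
    FreeAlgebra K (Fin n ⊕ Fin n) → FreeAlgebra K (Fin n ⊕ Fin n) → Prop
  | rel (i j : Fin n) : CohnRel K n
      (FreeAlgebra.ι K (Sum.inr i) * FreeAlgebra.ι K (Sum.inl j))
      (if i = j then 1 else 0)

/-- The Cohn algebra `C_K(n)`. -/
abbrev CohnAlgebra (K : Type) [Field K] (n : ℕ) := RingQuot (CohnRel K n)

/-- The generator `x_i` of the Cohn algebra. -/
def cX (K : Type) [Field K] (n : ℕ) (i : Fin n) : CohnAlgebra K n :=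
  RingQuot.mkAlgHom K (CohnRel K n) (FreeAlgebra.ι K (Sum.inl i))

/-- The generator `y_i` of the Cohn algebra. -/
def cY (K : Type) [Field K] (n : ℕ) (i : Fin n) : CohnAlgebra K n :=
  RingQuot.mkAlgHom K (CohnRel K n) (FreeAlgebra.ι K (Sum.inr i))

/-- `x_I` for a word `I` in the alphabet `{1, …, n}` (words are lists, the empty
list being the empty word, with `x_φ = 1`). -/
def xw (K : Type) [Field K] (n : ℕ) (I : List (Fin n)) : CohnAlgebra K n :=
  (I.map (cX K n)).prod

/-- `y_I` for a word `I`. -/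
def yw (K : Type) [Field K] (n : ℕ) (I : List (Fin n)) : CohnAlgebra K n :=
  (I.map (cY K n)).prod

/-- The Leavitt relation `∑ x_i y_i = 1`; quotienting `C_K(n)` by this relation is
the same as quotienting by the two-sided ideal `M` generated by `1 - ∑ x_i y_i`. -/
inductive LeavittRel (K : Type) [Field K] (n : ℕ) :
    CohnAlgebra K n → CohnAlgebra K n → Prop
  | rel : LeavittRel K n (∑ i : Fin n, cX K n i * cY K n i) 1

/-- The Leavitt algebra `L_K(n) = C_K(n)/M`. -/
abbrev LeavittAlgebra (K : Type) [Field K] (n : ℕ) := RingQuot (LeavittRel K n)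

/-- The canonical quotient map `C_K(n) → L_K(n)`, `z ↦ z̄`. -/
def leavittQuot (K : Type) [Field K] (n : ℕ) : CohnAlgebra K n →ₐ[K] LeavittAlgebra K n :=
  RingQuot.mkAlgHom K (LeavittRel K n)

section Nontriviality

variable (K : Type) [Field K] (n : ℕ)

/-- The generator `x_i` of the Leavitt algebra. -/
def leavittX (i : Fin n) : LeavittAlgebra K n := leavittQuot K n (cX K n i)

/-- The generator `y_i` of the Leavitt algebra. -/
def leavittY (i : Fin n) : LeavittAlgebra K n := leavittQuot K n (cY K n i)

theorem leavittY_mul_leavittX (i j : Fin n) :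
    leavittY K n i * leavittX K n j = if i = j then 1 else 0 := by
  have h := RingQuot.mkAlgHom_rel K (CohnRel.rel (K := K) i j)
  rw [map_mul] at h
  have h' := congrArg (leavittQuot K n) h
  rw [map_mul] at h'
  refine h'.trans ?_
  split_ifs <;> simp

/-- Prepending the digit `i` in base `n`, as an operator on functions `ℕ → K`:
the function `f` is transported to the residue class of `i` modulo `n`. -/
def digitShift [NeZero n] (i : Fin n) : Module.End K (ℕ → K) where
  toFun f m := if (Nat.divModEquiv n m).2 = i then f (Nat.divModEquiv n m).1 else 0
  map_add' f g := by ext m; dsimp only [Pi.add_apply]; split_ifs <;> simp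
  map_smul' c f := by ext m; simp

/-- Restriction of a function `ℕ → K` to the residue class of `i` modulo `n`. -/
def digitRestrict [NeZero n] (i : Fin n) : Module.End K (ℕ → K) :=
  LinearMap.funLeft K K fun m => (Nat.divModEquiv n).symm (m, i)

theorem digitRestrict_mul_digitShift [NeZero n] (i j : Fin n) :
    digitRestrict K n i * digitShift K n j = if i = j then 1 else 0 := by
  ext1 f
  funext m
  change (if ((Nat.divModEquiv n) ((Nat.divModEquiv n).symm (m, i))).2 = j then
    f ((Nat.divModEquiv n) ((Nat.divModEquiv n).symm (m, i))).1 else 0) = _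
  rw [Equiv.apply_symm_apply]
  split_ifs <;> rfl

theorem sum_digitShift_mul_digitRestrict [NeZero n] :
    ∑ i, digitShift K n i * digitRestrict K n i = 1 := by
  ext1 f
  funext m
  rw [LinearMap.sum_apply, Finset.sum_apply]
  change ∑ i, (if (Nat.divModEquiv n m).2 = i then
    f ((Nat.divModEquiv n).symm ((Nat.divModEquiv n m).1, i)) else 0) = f m
  rw [Finset.sum_ite_eq, if_pos (Finset.mem_univ _), Prod.mk.eta, Equiv.symm_apply_apply]

/-- The representation of the Cohn algebra on functions `ℕ → K` by base `n` digit operators. -/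
def cohnRep [NeZero n] : CohnAlgebra K n →ₐ[K] Module.End K (ℕ → K) :=
  RingQuot.liftAlgHom K ⟨FreeAlgebra.lift K (Sum.elim (digitShift K n) (digitRestrict K n)), by
    rintro _ _ ⟨i, j⟩
    rw [map_mul, FreeAlgebra.lift_ι_apply, FreeAlgebra.lift_ι_apply]
    refine (digitRestrict_mul_digitShift K n i j).trans ?_
    split_ifs <;> simp⟩

theorem cohnRep_cX [NeZero n] (i : Fin n) : cohnRep K n (cX K n i) = digitShift K n i := by
  simp [cohnRep, cX]

theorem cohnRep_cY [NeZero n] (i : Fin n) : cohnRep K n (cY K n i) = digitRestrict K n i := by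
  simp [cohnRep, cY]

/-- The representation of the Leavitt algebra on functions `ℕ → K` by base `n` digit operators. -/
def leavittRep [NeZero n] : LeavittAlgebra K n →ₐ[K] Module.End K (ℕ → K) :=
  RingQuot.liftAlgHom K ⟨cohnRep K n, by
    rintro _ _ ⟨⟩
    simp only [map_sum, map_mul, cohnRep_cX, cohnRep_cY, map_one]
    exact sum_digitShift_mul_digitRestrict K n⟩

theorem leavittAlgebra_nontrivial [NeZero n] : Nontrivial (LeavittAlgebra K n) :=
  (leavittRep K n).toRingHom.domain_nontrivial

end Nontriviality

section Corner

variable {K A : Type*} [Field K] [Ring A] [Algebra K A] {d : ℕ}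

/-- If `a` absorbs `e` on the left and is killed by it on the right, then the corner matrix with
entry `a` is a commutator. -/
theorem single_mem_derivedSeries_one (k : Fin d) {e a : A} (h : e * a = a) (h' : a * e = 0) :
    Matrix.single k k a ∈ LieAlgebra.derivedSeries K (Matrix (Fin d) (Fin d) A) 1 := by
  have hb : ⁅Matrix.single k k e, Matrix.single k k a⁆ = Matrix.single k k a := by
    rw [Ring.lie_def, Matrix.single_mul_single_same, Matrix.single_mul_single_same, h, h',
      Matrix.single_zero, sub_zero]
  rw [← hb]
  exact LieSubmodule.lie_mem_lie (LieSubmodule.mem_top _) (LieSubmodule.mem_top _)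

/-- A nontrivial algebra that is not Dedekind-finite is infinite dimensional. -/
theorem not_finite_of_leavitt_pair [Nontrivial A] {x₀ x₁ y₀ y₁ : A} (h₀₀ : y₀ * x₀ = 1)
    (h₁₁ : y₁ * x₁ = 1) (h₁₀ : y₁ * x₀ = 0) : ¬ Module.Finite K A := by
  intro hfin
  have : IsNoetherianRing A := isNoetherian_of_tower K inferInstance
  have hi : x₀ * y₀ = 1 := mul_eq_one_symm h₀₀
  have hj : y₁ = 0 := by rw [← mul_one y₁, ← hi, ← mul_assoc, h₁₀, zero_mul]
  rw [hj, zero_mul] at h₁₁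
  exact zero_ne_one h₁₁

/-- A matrix algebra over an algebra with two orthogonal pairs `y₀ x₀ = 1 = y₁ x₁` has an
infinite-dimensional derived Lie algebra, which is not abelian. -/
theorem matrix_nontriviality_of_leavitt_pair [Nontrivial A] {x₀ x₁ y₀ y₁ : A} (hd : 1 ≤ d)
    (h₀₀ : y₀ * x₀ = 1) (h₁₁ : y₁ * x₁ = 1) (h₀₁ : y₀ * x₁ = 0) (h₁₀ : y₁ * x₀ = 0) :
    ¬ Module.Finite K (LieAlgebra.derivedSeries K (Matrix (Fin d) (Fin d) A) 1) ∧
    ¬ Module.Finite K (Matrix (Fin d) (Fin d) A) ∧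
    LieAlgebra.derivedSeries K (Matrix (Fin d) (Fin d) A) 2 ≠ ⊥ := by
  let k : Fin d := ⟨0, hd⟩
  have hmem (a : A) : Matrix.single k k (x₀ * a * y₁) ∈
      LieAlgebra.derivedSeries K (Matrix (Fin d) (Fin d) A) 1 := by
    apply single_mem_derivedSeries_one k (e := x₀ * y₀)
    · rw [← mul_assoc, ← mul_assoc, mul_assoc x₀, h₀₀, mul_one]
    · rw [mul_assoc _ y₁, ← mul_assoc y₁, h₁₀, zero_mul, mul_zero]
  have hmem' : Matrix.single k k (x₁ * y₀) ∈
      LieAlgebra.derivedSeries K (Matrix (Fin d) (Fin d) A) 1 := by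
    apply single_mem_derivedSeries_one k (e := x₁ * y₁)
    · rw [← mul_assoc, mul_assoc x₁, h₁₁, mul_one]
    · rw [mul_assoc _ y₀, ← mul_assoc y₀, h₀₁, zero_mul, mul_zero]
  have hfin : ¬ Module.Finite K (LieAlgebra.derivedSeries K (Matrix (Fin d) (Fin d) A) 1) := by
    intro hW
    let f : A →ₗ[K] LieAlgebra.derivedSeries K (Matrix (Fin d) (Fin d) A) 1 :=
      { toFun a := ⟨Matrix.single k k (x₀ * a * y₁), hmem a⟩
        map_add' a b := Subtype.ext <| by simp [mul_add, add_mul, Matrix.single_add]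
        map_smul' c a := Subtype.ext <| by simp [Matrix.smul_single] }
    refine not_finite_of_leavitt_pair h₀₀ h₁₁ h₁₀ (Module.Finite.of_injective f fun a b hab => ?_)
    have h := congrFun (congrFun (congrArg Subtype.val hab) k) k
    have h' : x₀ * a * y₁ = x₀ * b * y₁ := by simpa [f] using h
    have hc (c : A) : y₀ * (x₀ * c * y₁) * x₁ = c := by
      rw [← mul_assoc, ← mul_assoc, h₀₀, one_mul, mul_assoc, h₁₁, mul_one]
    rw [← hc a, h', hc]
  refine ⟨hfin, fun hS => hfin ?_, fun hbot => ?_⟩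
  · exact Module.Finite.of_injective (LieAlgebra.derivedSeries K _ 1).toSubmodule.subtype
      Subtype.val_injective
  · have hbr : ⁅Matrix.single k k (x₀ * 1 * y₁), Matrix.single k k (x₁ * y₀)⁆ ∈
        LieAlgebra.derivedSeries K (Matrix (Fin d) (Fin d) A) 2 :=
      LieSubmodule.lie_mem_lie (hmem 1) hmem'
    rw [hbot, LieSubmodule.mem_bot, Ring.lie_def, Matrix.single_mul_single_same,
      Matrix.single_mul_single_same] at hbr
    have h := congrFun (congrFun hbr k) k
    have h' : x₀ * y₀ - x₁ * y₁ = 0 := by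
      rw [mul_one, mul_assoc x₀, ← mul_assoc y₁, h₁₁, one_mul, mul_assoc x₁,
        ← mul_assoc y₀, h₀₀, one_mul] at h
      simpa using h
    have h1 : y₀ * (x₀ * y₀ - x₁ * y₁) * x₀ = 1 := by
      rw [mul_sub, ← mul_assoc, ← mul_assoc, h₀₀, h₀₁, one_mul, zero_mul, sub_zero, h₀₀]
    rw [h', mul_zero, zero_mul] at h1
    exact zero_ne_one h1

end Corner

/-- Corollary 3.2: for `S = M_d(L_K(n))`: (i) `[S⁻, S⁻]` is infinite
dimensional over `K`; (ii) `S` is infinite dimensional over `K`; (iii) with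
`W = [S⁻, S⁻]`, `[W, W] ≠ {0}`. -/
theorem matrix_nontriviality (K : Type) [Field K] (n d : ℕ) (hn : 2 ≤ n) (hd : 1 ≤ d) :
    ¬ Module.Finite K
        (LieAlgebra.derivedSeries K (Matrix (Fin d) (Fin d) (LeavittAlgebra K n)) 1) ∧
    ¬ Module.Finite K (Matrix (Fin d) (Fin d) (LeavittAlgebra K n)) ∧
    LieAlgebra.derivedSeries K (Matrix (Fin d) (Fin d) (LeavittAlgebra K n)) 2 ≠ ⊥ := by
  have : NeZero n := ⟨by omega⟩
  have := leavittAlgebra_nontrivial K n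
  let i : Fin n := ⟨0, by omega⟩
  let j : Fin n := ⟨1, by omega⟩
  have hij : i ≠ j := by simp [i, j]
  exact matrix_nontriviality_of_leavitt_pair (x₀ := leavittX K n i) (x₁ := leavittX K n j)
    (y₀ := leavittY K n i) (y₁ := leavittY K n j) hd
    (by simp [leavittY_mul_leavittX]) (by simp [leavittY_mul_leavittX])
    (by simp [leavittY_mul_leavittX, hij]) (by simp [leavittY_mul_leavittX, hij.symm])
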